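/- For all left Λ-modules M and N over the Gelfand order Λ and all integers n ≥ 3, the extension group Ext^n_Λ(M,N) vanishes; i.e. the global dimension of the category of left Λ-modules is at most two. -/

import Mathlib

set_option maxHeartbeats 1600000
set_option synthInstance.maxHeartbeats 400000

noncomputable section

variable (k : Type) [Field k]

/-- The maximal ideal `m = (t)` of `R = k⟦t⟧`. -/
def mIdeal : Ideal (PowerSeries k) :=
  Ideal.span {PowerSeries.X}

lemma X_mem_mIdeal : (PowerSeries.X : PowerSeries k) ∈ mIdeal k :=
  Ideal.subset_span rfl

/-- The Gelfand order `Λ ⊆ M₃(k⟦t⟧)`: all matrices `A` with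
`A₁₂, A₁₃, A₂₃, A₃₂ ∈ m`. -/
def gelfandOrder : Subalgebra k (Matrix (Fin 3) (Fin 3) (PowerSeries k)) where
  carrier := {A | A 0 1 ∈ mIdeal k ∧ A 0 2 ∈ mIdeal k ∧ A 1 2 ∈ mIdeal k ∧ A 2 1 ∈ mIdeal k}
  zero_mem' := ⟨zero_mem _, zero_mem _, zero_mem _, zero_mem _⟩
  one_mem' := by
    refine ⟨?_, ?_, ?_, ?_⟩ <;>
    · rw [Matrix.one_apply_ne (by decide)]
      exact zero_mem _
  add_mem' := by
    rintro a b ⟨ha1, ha2, ha3, ha4⟩ ⟨hb1, hb2, hb3, hb4⟩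
    exact ⟨add_mem ha1 hb1, add_mem ha2 hb2, add_mem ha3 hb3, add_mem ha4 hb4⟩
  mul_mem' := by
    rintro a b ⟨ha1, ha2, ha3, ha4⟩ ⟨hb1, hb2, hb3, hb4⟩
    refine ⟨?_, ?_, ?_, ?_⟩ <;>
      simp only [Set.mem_setOf_eq, Matrix.mul_apply, Fin.sum_univ_three]
    · exact add_mem (add_mem (Ideal.mul_mem_left _ _ hb1) (Ideal.mul_mem_right _ _ ha1))
        (Ideal.mul_mem_left _ _ hb4)
    · exact add_mem (add_mem (Ideal.mul_mem_left _ _ hb2) (Ideal.mul_mem_left _ _ hb3))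
        (Ideal.mul_mem_right _ _ ha2)
    · exact add_mem (add_mem (Ideal.mul_mem_left _ _ hb2) (Ideal.mul_mem_left _ _ hb3))
        (Ideal.mul_mem_right _ _ ha3)
    · exact add_mem (add_mem (Ideal.mul_mem_left _ _ hb1) (Ideal.mul_mem_right _ _ ha4))
        (Ideal.mul_mem_left _ _ hb4)
  algebraMap_mem' := by
    intro r
    refine ⟨?_, ?_, ?_, ?_⟩ <;>
    · rw [Matrix.algebraMap_matrix_apply, if_neg (by decide)]
      exact zero_mem _


namespace GelfandAux

open CategoryTheory

section general
variable {A : Type} [Ring A]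

/-- Module version of `HasProjectiveDimensionLT`. -/
abbrev PdLT (A : Type) [Ring A] (M : Type) [AddCommGroup M] [Module A M] (n : ℕ) : Prop :=
  HasProjectiveDimensionLT (ModuleCat.of A M) n

variable {M N : Type} [AddCommGroup M] [Module A M] [AddCommGroup N] [Module A N]

lemma pd_mono {m n : ℕ} (h : PdLT A M m) (hmn : m ≤ n) : PdLT A M n :=
  hasProjectiveDimensionLT_of_ge _ m n hmn

lemma pd_of_projective (h : Module.Projective A M) : PdLT A M 1 := by
  have := (IsProjective.iff_projective (R := A) M).1 h
  infer_instance

lemma pd_equiv {n : ℕ} (e : M ≃ₗ[A] N) (h : PdLT A M n) : PdLT A N n :=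
  hasProjectiveDimensionLT_of_iso e.toModuleIso n

lemma pd_surj {n : ℕ} (f : M →ₗ[A] N) (hf : Function.Surjective f)
    (h1 : PdLT A (LinearMap.ker f) n) (h2 : PdLT A M (n + 1)) : PdLT A N (n + 1) :=
  (LinearMap.shortExact_shortComplexKer hf).hasProjectiveDimensionLT_X₃ n h1 h2

lemma pd_mid {n : ℕ} (f : M →ₗ[A] N) (hf : Function.Surjective f)
    (h1 : PdLT A (LinearMap.ker f) n) (h2 : PdLT A N n) : PdLT A M n :=
  (LinearMap.shortExact_shortComplexKer hf).hasProjectiveDimensionLT_X₂ n h1 h2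

lemma pd_two (f : M →ₗ[A] N) (hf : Function.Surjective f)
    (h1 : Module.Projective A (LinearMap.ker f)) (h2 : Module.Projective A M) : PdLT A N 2 :=
  pd_surj f hf (pd_of_projective h1) (pd_mono (pd_of_projective h2) one_le_two)

lemma pd_two' {L : Type} [AddCommGroup L] [Module A L] (g : L →ₗ[A] M) (f : M →ₗ[A] N)
    (hf : Function.Surjective f) (hg : Function.Injective g) (h0 : ∀ x, f (g x) = 0)
    (h : ∀ y, f y = 0 → ∃ x, g x = y)
    (h1 : Module.Projective A L) (h2 : Module.Projective A M) : PdLT A N 2 := by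
  refine pd_two f hf ?_ h2
  refine Module.Projective.of_equiv (LinearEquiv.ofBijective (g.codRestrict (LinearMap.ker f) h0)
    ⟨fun x y hxy => hg (congr_arg Subtype.val hxy), ?_⟩)
  rintro ⟨y, hy⟩
  obtain ⟨x, hx⟩ := h y hy
  exact ⟨x, Subtype.ext hx⟩

lemma proj_finsupp {ι : Type} (h : Module.Projective A M) : Module.Projective A (ι →₀ M) := by
  classical
  exact Module.Projective.of_equiv (finsuppLequivDFinsupp (M := M) (ι := ι) A).symm

lemma pd_two_finsupp {ι : Type} {L : Type} [AddCommGroup L] [Module A L] (g : L →ₗ[A] M)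
    (f : (ι →₀ M) →ₗ[A] N) (hf : Function.Surjective f) (hg : Function.Injective g)
    (h0 : ∀ x : ι →₀ L, f (x.mapRange g (map_zero g)) = 0)
    (h : ∀ y, f y = 0 → ∀ i, ∃ x, g x = y i)
    (h1 : Module.Projective A L) (h2 : Module.Projective A M) : PdLT A N 2 := by
  refine pd_two' (L := ι →₀ L) (Finsupp.mapRange.linearMap g) f hf ?_ h0 ?_
    (proj_finsupp h1) (proj_finsupp h2)
  · exact Finsupp.mapRange_injective g (map_zero g) hg
  · intro y hy
    choose u hu using h y hy
    refine ⟨Finsupp.onFinset y.support u (fun i hi => ?_), ?_⟩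
    · rw [Finsupp.mem_support_iff]
      intro h'
      exact hi (hg (by rw [hu, h', map_zero]))
    · ext i
      exact hu i

/-- If kernel and cokernel of `f` have pd at most one and the source too, the target has
pd at most two. -/
lemma pd_three (f : M →ₗ[A] N) (h0 : PdLT A M 2) (h1 : PdLT A (LinearMap.ker f) 2)
    (h2 : PdLT A (N ⧸ LinearMap.range f) 2) : PdLT A N 3 := by
  have h3 : PdLT A (LinearMap.range f) 3 := by
    refine pd_surj (N := LinearMap.range f) f.rangeRestrict f.surjective_rangeRestrict ?_ (pd_mono h0 (by norm_num))
    rw [LinearMap.ker_rangeRestrict]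
    exact h1
  refine pd_mid (LinearMap.range f).mkQ (Submodule.mkQ_surjective _) ?_ (pd_mono h2 (by norm_num))
  rw [Submodule.ker_mkQ]
  exact h3

end general

open Matrix.Module


lemma mem_mIdeal {f : PowerSeries k} : f ∈ mIdeal k ↔ PowerSeries.X ∣ f := Ideal.mem_span_singleton

lemma mem_iff (A : Matrix (Fin 3) (Fin 3) (PowerSeries k)) :
    A ∈ gelfandOrder k ↔ ∀ i j, j ≠ 0 → i ≠ j → A i j ∈ mIdeal k := by
  constructor
  · rintro ⟨h1, h2, h3, h4⟩ i j hj hij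
    fin_cases i <;> fin_cases j <;> first | assumption | simp at hj hij
  · intro h
    exact ⟨h _ _ (by decide) (by decide), h _ _ (by decide) (by decide),
      h _ _ (by decide) (by decide), h _ _ (by decide) (by decide)⟩

/-- scalars -/
def scal : PowerSeries k →+* gelfandOrder k :=
  (Matrix.scalar (Fin 3)).codRestrict (gelfandOrder k).toSubring (fun r => by
    show _ ∈ gelfandOrder k
    rw [mem_iff]
    intro i j _ hij
    rw [Matrix.scalar_apply, Matrix.diagonal_apply_ne _ hij]
    exact zero_mem _)

lemma scal_val (r : PowerSeries k) : (scal k r : Matrix (Fin 3) (Fin 3) (PowerSeries k)) = Matrix.scalar (Fin 3) r := rfl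

instance algR : Algebra (PowerSeries k) (gelfandOrder k) := (scal k).toAlgebra' (fun c x => by
  apply Subtype.ext
  show Matrix.scalar (Fin 3) c * x.1 = x.1 * Matrix.scalar (Fin 3) c
  exact (Matrix.scalar_commute c (fun r => mul_comm _ _) x.1).eq)

lemma smul_val (r : PowerSeries k) (x : gelfandOrder k) : ((r • x : gelfandOrder k) : Matrix (Fin 3) (Fin 3) (PowerSeries k)) = r • x.1 := by
  show Matrix.scalar (Fin 3) r * x.1 = _
  simp [Matrix.smul_eq_diagonal_mul]

/-- `E_{i1}` -/
def E (i : Fin 3) : gelfandOrder k := ⟨Matrix.single i 0 1, by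
  rw [mem_iff]
  intro a b hb _
  rw [Matrix.single_apply_of_col_ne _ _ (Ne.symm hb)]
  exact zero_mem _⟩

/-- `E_{jj}` -/
def ee (i : Fin 3) : gelfandOrder k := ⟨Matrix.single i i 1, by
  rw [mem_iff]
  intro a b _ hab
  rw [Matrix.single_apply_of_ne]
  · exact zero_mem _
  · rintro ⟨rfl, rfl⟩; exact hab rfl⟩

/-- `t E_{1j}` -/
def bb (j : Fin 3) : gelfandOrder k := ⟨Matrix.single 0 j PowerSeries.X, by
  rw [mem_iff]
  intro a b _ hab
  rw [Matrix.single_apply]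
  split_ifs
  · exact X_mem_mIdeal k
  · exact zero_mem _⟩

lemma mul_E (x : gelfandOrder k) (j : Fin 3) : x * E k j = ∑ i, x.1 i j • E k i := by
  apply Subtype.ext
  rw [AddSubmonoidClass.coe_finsetSum]
  simp_rw [smul_val]
  show x.1 * Matrix.single j 0 1 = ∑ i, x.1 i j • Matrix.single i 0 1
  ext a b
  simp [Matrix.mul_apply, Matrix.single_apply, Matrix.sum_apply, Fin.sum_univ_three]
  fin_cases a <;> fin_cases b <;> fin_cases j <;> simp

lemma E_zero : E k 0 = ee k 0 := rfl

section ind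
variable {A B X : Type} [AddCommGroup A] [Module (PowerSeries k) A] [AddCommGroup B] [Module (PowerSeries k) B]
  [AddCommGroup X] [Module (gelfandOrder k) X] [Module (PowerSeries k) X] [IsScalarTower (PowerSeries k) (gelfandOrder k) X]

lemma smul_fun_apply (x : gelfandOrder k) (v : Fin 3 → A) (i : Fin 3) : (x • v) i = ∑ j, x.1 i j • v j := rfl

/-- extension of an `PowerSeries k`-linear map to the induced module. -/
def T (h : A →ₗ[PowerSeries k] X) : (Fin 3 → A) →ₗ[gelfandOrder k] X where
  toFun v := ∑ i, E k i • h (v i)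
  map_add' v w := by simp [smul_add, Finset.sum_add_distrib]
  map_smul' x v := by
    simp only [smul_fun_apply, map_sum, map_smul, Finset.smul_sum, RingHom.id_apply]
    rw [Finset.sum_comm]
    refine Finset.sum_congr rfl fun j _ => ?_
    rw [← mul_smul, mul_E, Finset.sum_smul]
    refine Finset.sum_congr rfl fun i _ => ?_
    rw [smul_assoc, smul_algebra_smul_comm]

lemma T_apply (h : A →ₗ[PowerSeries k] X) (v : Fin 3 → A) : T k h v = ∑ i, E k i • h (v i) := rfl

/-- functoriality -/
def mapInd (h : A →ₗ[PowerSeries k] B) : (Fin 3 → A) →ₗ[gelfandOrder k] (Fin 3 → B) where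
  toFun v i := h (v i)
  map_add' v w := by ext; simp
  map_smul' x v := by ext i; simp [smul_fun_apply]

lemma E_smul (i : Fin 3) (v : Fin 3 → A) : E k i • v = Pi.single i (v 0) := by
  show (Matrix.single i 0 1 : Matrix (Fin 3) (Fin 3) (PowerSeries k)) • v = _
  simp

lemma proj_ind (hA : Module.Projective (PowerSeries k) A) : Module.Projective (gelfandOrder k) (Fin 3 → A) := by
  refine Module.Projective.of_lifting_property'' fun f hf => ?_
  have hs : ∀ (r : PowerSeries k) (x : (Fin 3 → A) →₀ (gelfandOrder k)), f (r • x) = r • f x := by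
    intro r x
    have : r • x = (algebraMap (PowerSeries k) (gelfandOrder k) r) • x := (algebraMap_smul (gelfandOrder k) r x).symm
    rw [this, map_smul]
    ext i
    show ∑ j, Matrix.scalar (Fin 3) r i j • f x j = _
    simp [Matrix.diagonal_apply]
  let f' : ((Fin 3 → A) →₀ (gelfandOrder k)) →ₗ[PowerSeries k] (Fin 3 → A) := { f with map_smul' := hs }
  obtain ⟨h, hh⟩ := Module.projective_lifting_property f' (LinearMap.single (PowerSeries k) (fun _ : Fin 3 => A) 0) hf
  refine ⟨T k (X := (Fin 3 → A) →₀ gelfandOrder k) h, ?_⟩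
  have hh' : ∀ a, f (h a) = Pi.single 0 a := fun a => LinearMap.congr_fun hh a
  ext v : 1
  simp only [LinearMap.comp_apply, T_apply, map_sum, map_smul, hh', E_smul, LinearMap.id_apply,
    Pi.single_eq_same]
  exact Finset.univ_sum_single v

lemma pid_sub {S P : Type} [CommRing S] [IsDomain S] [IsPrincipalIdealRing S] [AddCommGroup P]
    [Module S P] [Module.Projective S P] (K : Submodule S P) : Module.Projective S K := by
  refine Module.Projective.of_lifting_property'' fun f hf => ?_
  let I := Injective.under (ModuleCat.of S (K →₀ S))
  let ι : (K →₀ S) →ₗ[S] I := (Injective.ι (ModuleCat.of S (K →₀ S))).hom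
  have hι : Function.Injective ι := (ModuleCat.mono_iff_injective _).1 inferInstance
  have hI : Module.Injective S I := by
    have : Injective (ModuleCat.of S I) := inferInstanceAs (Injective (Injective.under (ModuleCat.of S (K →₀ S))))
    exact Module.injective_module_of_injective_object S I
  have hB : Module.Baer S I := Module.Baer.of_injective hI
  let L := (LinearMap.ker f).map ι
  have hB' : Module.Baer S (I ⧸ L) := by
    intro J g
    obtain ⟨g', hg'⟩ := Module.projective_lifting_property L.mkQ g (Submodule.mkQ_surjective L)
    obtain ⟨g'', hg''⟩ := hB J g'
    refine ⟨L.mkQ ∘ₗ g'', fun x hx => ?_⟩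
    rw [LinearMap.comp_apply, hg'' x hx, ← hg', LinearMap.comp_apply]
  let e := f.quotKerEquivOfSurjective hf
  let φ : ((K →₀ S) ⧸ LinearMap.ker f) →ₗ[S] I ⧸ L := Submodule.mapQ _ _ ι (Submodule.le_comap_map _ _)
  obtain ⟨ψ, hψ⟩ := hB'.extension_property K.subtype K.injective_subtype (φ ∘ₗ e.symm.toLinearMap)
  obtain ⟨χ, hχ⟩ := Module.projective_lifting_property L.mkQ ψ (Submodule.mkQ_surjective L)
  have key : ∀ x : K, ∃ y, f y = x ∧ ι y = χ x := by
    intro x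
    obtain ⟨y, hy⟩ := hf x
    have h1 : ψ x = L.mkQ (ι y) := by
      have := LinearMap.congr_fun hψ x
      simp only [LinearMap.comp_apply, Submodule.subtype_apply] at this
      rw [this]
      have h2 : e.symm x = Submodule.Quotient.mk y := by
        rw [LinearEquiv.symm_apply_eq, ← hy]
        rfl
      show φ (e.symm x) = _
      rw [h2]
      rfl
    have h3 : L.mkQ (χ x) = ψ x := LinearMap.congr_fun hχ x
    rw [h1, ← sub_eq_zero, ← map_sub, Submodule.mkQ_apply, Submodule.Quotient.mk_eq_zero] at h3
    obtain ⟨z, hz, hz'⟩ := h3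
    refine ⟨y + z, ?_, ?_⟩
    · rw [map_add, hy, show f z = 0 from hz, add_zero]
    · rw [map_add, hz']; abel
  choose s hs1 hs2 using key
  refine ⟨{ toFun := s, map_add' := fun x y => hι ?_, map_smul' := fun r x => hι ?_ }, ?_⟩
  · rw [map_add, hs2, hs2, hs2]; simp
  · rw [RingHom.id_apply, map_smul, hs2, hs2]; simp
  · ext x : 1
    exact hs1 x

lemma pd_ind : PdLT (gelfandOrder k) (Fin 3 → A) 2 := by
  let p := Finsupp.linearCombination (PowerSeries k) (id : A → A)
  have hp : Function.Surjective p := Finsupp.linearCombination_id_surjective (PowerSeries k) A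
  refine pd_two' (L := Fin 3 → LinearMap.ker p) (M := Fin 3 → (A →₀ PowerSeries k))
    (mapInd k (A := LinearMap.ker p) (LinearMap.ker p).subtype) (mapInd k p) ?_ ?_ ?_ ?_
    (proj_ind k (A := LinearMap.ker p) (pid_sub _)) (proj_ind k inferInstance)
  · intro v
    choose w hw using fun i => hp (v i)
    exact ⟨w, funext hw⟩
  · intro v w h
    ext i : 1
    exact Subtype.ext (congr_fun h i)
  · intro v
    ext i
    exact (v i).2
  · intro v hv
    exact ⟨fun i => ⟨v i, congr_fun hv i⟩, rfl⟩

end ind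

/-- The left ideal of all `x` with `x_{jj} ∈ m`. -/
def J (j : Fin 3) (hj : j ≠ 0) : Submodule (gelfandOrder k) (gelfandOrder k) where
  carrier := {x | x.1 j j ∈ mIdeal k}
  zero_mem' := zero_mem (mIdeal k)
  add_mem' := fun {x y} hx hy => by
    show x.1 j j + y.1 j j ∈ mIdeal k
    exact add_mem hx hy
  smul_mem' := fun c x hx => by
    show (c.1 * x.1) j j ∈ mIdeal k
    rw [Matrix.mul_apply]
    refine sum_mem fun i _ => Ideal.mul_mem_left _ _ ?_
    by_cases hij : i = j
    · subst hij; exact hx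
    · exact (mem_iff k x.1).1 x.2 i j hj hij

lemma mem_J {j : Fin 3} {hj : j ≠ 0} {x : gelfandOrder k} : x ∈ J k j hj ↔ x.1 j j ∈ mIdeal k := Iff.rfl

lemma exists_div {j : Fin 3} {hj : j ≠ 0} {x : gelfandOrder k} (hx : x ∈ J k j hj) :
    ∃ d : gelfandOrder k, d * ee k 0 = d ∧ d * bb k j = x * ee k j := by
  have h : ∀ i, ∃ r : PowerSeries k, x.1 i j = r * PowerSeries.X := by
    intro i
    have : x.1 i j ∈ mIdeal k := by
      by_cases hij : i = j
      · subst hij; exact hx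
      · exact (mem_iff k x.1).1 x.2 i j hj hij
    obtain ⟨r, hr⟩ := (mem_mIdeal k).1 this
    exact ⟨r, by rw [hr, mul_comm]⟩
  choose r hr using h
  refine ⟨⟨Matrix.of fun a b => if b = 0 then r a else 0, ?_⟩, ?_, ?_⟩
  · rw [mem_iff]
    intro a b hb _
    simp [hb]
  · apply Subtype.ext
    show Matrix.of _ * Matrix.single 0 0 1 = _
    ext a b
    by_cases hb : b = 0
    · subst hb; simp
    · simp [hb, Matrix.mul_single_apply_of_ne]
  · apply Subtype.ext
    show Matrix.of _ * Matrix.single 0 j PowerSeries.X = x.1 * Matrix.single j j 1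
    ext a b
    by_cases hb : b = j
    · subst hb; simp [hr]
    · simp [hb, Matrix.mul_single_apply_of_ne]

lemma div_unique {j : Fin 3} {d d' : gelfandOrder k} (h : d * ee k 0 = d) (h' : d' * ee k 0 = d')
    (e : d * bb k j = d' * bb k j) : d = d' := by
  apply Subtype.ext
  ext1 a b
  have h1 : ∀ y : gelfandOrder k, y * ee k 0 = y → b ≠ 0 → y.1 a b = 0 := by
    intro y hy hb
    rw [← hy]
    show (y.1 * Matrix.single 0 0 1 : Matrix (Fin 3) (Fin 3) (PowerSeries k)) a b = 0
    rw [Matrix.mul_single_apply_of_ne _ _ _ _ _ hb]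
  by_cases hb : b = 0
  · subst hb
    have := congr_fun (congr_fun (congr_arg Subtype.val e) a) j
    change (d.1 * Matrix.single 0 j PowerSeries.X :
      Matrix (Fin 3) (Fin 3) (PowerSeries k)) a j = (d'.1 * Matrix.single 0 j PowerSeries.X :
      Matrix (Fin 3) (Fin 3) (PowerSeries k)) a j
      at this
    rw [Matrix.mul_single_apply_same, Matrix.mul_single_apply_same] at this
    exact mul_right_cancel₀ PowerSeries.X_ne_zero this
  · rw [h1 d h hb, h1 d' h' hb]

lemma ee_mul_ee (j : Fin 3) : ee k j * ee k j = ee k j := by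
  apply Subtype.ext
  show Matrix.single j j 1 * Matrix.single j j 1 = Matrix.single j j 1
  simp

lemma bb_mul_ee (j : Fin 3) : bb k j * ee k j = bb k j := by
  apply Subtype.ext
  show Matrix.single 0 j PowerSeries.X * Matrix.single j j 1 = Matrix.single 0 j PowerSeries.X
  simp

lemma ee_mul_bb (j : Fin 3) : ee k 0 * bb k j = bb k j := by
  apply Subtype.ext
  show Matrix.single 0 0 1 * Matrix.single 0 j PowerSeries.X = Matrix.single 0 j PowerSeries.X
  simp

lemma mul_ee_val (x : gelfandOrder k) (j : Fin 3) (a b : Fin 3) :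
    (x * ee k j).1 a b = if b = j then x.1 a b else 0 := by
  show (x.1 * Matrix.single j j 1 : Matrix (Fin 3) (Fin 3) (PowerSeries k)) a b = _
  split_ifs with h
  · subst h; simp
  · rw [Matrix.mul_single_apply_of_ne _ _ _ _ _ h]

lemma ee_mul_val (x : gelfandOrder k) (j : Fin 3) (a b : Fin 3) :
    (ee k j * x).1 a b = if a = j then x.1 a b else 0 := by
  show (Matrix.single j j 1 * x.1 : Matrix (Fin 3) (Fin 3) (PowerSeries k)) a b = _
  split_ifs with h
  · subst h; simp
  · rw [Matrix.single_mul_apply_of_ne _ _ _ _ _ h]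

lemma proj_J (j : Fin 3) (hj : j ≠ 0) : Module.Projective (gelfandOrder k) (J k j hj) := by
  choose D hD1 hD2 using fun x : J k j hj => exists_div k x.2
  let i : J k j hj →ₗ[gelfandOrder k] gelfandOrder k × gelfandOrder k :=
    { toFun := fun x => (x.1, D x)
      map_add' := fun x y => Prod.ext rfl (div_unique k (j := j) (hD1 _)
        (by show (D x + D y) * _ = D x + D y
            rw [add_mul, hD1, hD1])
        (by show _ = (D x + D y) * _
            rw [add_mul, hD2, hD2, hD2, ← add_mul]; rfl))
      map_smul' := fun c x => Prod.ext rfl (div_unique k (j := j) (hD1 _)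
        (by show (c * D x) * _ = c * D x
            rw [mul_assoc, hD1])
        (by show _ = (c * D x) * _
            rw [mul_assoc, hD2, hD2, ← mul_assoc]; rfl)) }
  let s0 : gelfandOrder k × gelfandOrder k →ₗ[gelfandOrder k] gelfandOrder k :=
    (LinearMap.toSpanSingleton (gelfandOrder k) (gelfandOrder k) (1 - ee k j)).coprod (LinearMap.toSpanSingleton (gelfandOrder k) (gelfandOrder k) (bb k j))
  have hs0 : ∀ p, s0 p = p.1 * (1 - ee k j) + p.2 * bb k j := fun p => rfl
  have hmem : ∀ p, s0 p ∈ J k j hj := by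
    intro p
    rw [hs0]
    refine add_mem (Submodule.smul_mem _ p.1 ?_) (Submodule.smul_mem _ p.2 ?_)
    · rw [mem_J]
      show (1 - Matrix.single j j 1 : Matrix (Fin 3) (Fin 3) (PowerSeries k)) j j ∈ _
      simp
    · rw [mem_J]
      show (Matrix.single 0 j PowerSeries.X : Matrix (Fin 3) (Fin 3) (PowerSeries k)) j j ∈ _
      simp [Ne.symm hj]
  refine Module.Projective.of_split i (s0.codRestrict _ hmem) ?_
  ext x : 2
  show s0 (x.1, D x) = x.1
  rw [hs0, hD2, mul_sub, mul_one, sub_add_cancel]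

section simple
variable {C : Type} [AddCommGroup C] [Module (gelfandOrder k) C]

lemma pd_simple (j : Fin 3) (hj : j ≠ 0) (hC : ∀ x ∈ J k j hj, ∀ c : C, x • c = 0) :
    PdLT (gelfandOrder k) C 2 := by
  let _ : Module k C := Module.compHom C (algebraMap k (gelfandOrder k))
  have hk : ∀ (r : k) (c : C), r • c = algebraMap k (gelfandOrder k) r • c := fun _ _ => rfl
  let ε : gelfandOrder k → k := fun x => PowerSeries.constantCoeff (x.1 j j)
  have hε : ∀ (x : gelfandOrder k) (c : C), x • c = ε x • c := by
    intro x c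
    rw [hk, ← sub_eq_zero, ← sub_smul]
    apply hC
    rw [mem_J, mem_mIdeal, PowerSeries.X_dvd_iff]
    show PowerSeries.constantCoeff (x.1 j j - (algebraMap k (Matrix (Fin 3) (Fin 3) (PowerSeries k)) (ε x)) j j) = 0
    rw [Matrix.algebraMap_matrix_apply, if_pos rfl, map_sub, sub_eq_zero]
    simp [ε]
  have hεJ : ∀ x, x ∈ J k j hj ↔ ε x = 0 := by
    intro x
    rw [mem_J, mem_mIdeal, PowerSeries.X_dvd_iff]
  have hε0 : ε 0 = 0 := by simp [ε]
  let b := Module.Basis.ofVectorSpace k C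
  let p := Finsupp.linearCombination (gelfandOrder k) b
  have hp : ∀ f, p f = Finsupp.linearCombination k b (f.mapRange ε hε0) := by
    intro f
    show Finsupp.linearCombination (gelfandOrder k) b f = _
    rw [Finsupp.linearCombination_apply, Finsupp.linearCombination_apply,
      Finsupp.sum_mapRange_index (by simp)]
    simp only [hε]
  refine pd_two_finsupp (L := J k j hj) (J k j hj).subtype p ?_ Subtype.val_injective ?_ ?_
    (proj_J k j hj) inferInstance
  · intro c
    refine ⟨(b.repr c).mapRange (algebraMap k (gelfandOrder k)) (map_zero _), ?_⟩
    show Finsupp.linearCombination (gelfandOrder k) b _ = _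
    rw [Finsupp.linearCombination_apply, Finsupp.sum_mapRange_index (by simp)]
    simp only [← hk]
    exact b.linearCombination_repr c
  · intro v
    rw [hp]
    convert map_zero (Finsupp.linearCombination k b)
    ext i
    exact (hεJ _).1 (v i).2
  · intro f hf
    rw [hp] at hf
    have hf' : f.mapRange ε hε0 = 0 := b.linearIndependent (by rw [hf, map_zero])
    have hm : ∀ i, f i ∈ J k j hj := fun i => (hεJ _).2 (DFunLike.congr_fun hf' i)
    exact fun i => ⟨⟨f i, hm i⟩, rfl⟩

lemma one_eq : (1 : gelfandOrder k) = ee k 0 + ee k 1 + ee k 2 := by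
  apply Subtype.ext
  show (1 : Matrix (Fin 3) (Fin 3) (PowerSeries k)) =
    Matrix.single 0 0 1 + Matrix.single 1 1 1 + Matrix.single 2 2 1
  ext a b
  fin_cases a <;> fin_cases b <;> simp

lemma kill (hC : ∀ c : C, ee k 0 • c = 0) (x : gelfandOrder k) (h1 : x.1 1 1 ∈ mIdeal k)
    (h2 : x.1 2 2 ∈ mIdeal k) (c : C) : x • c = 0 := by
  obtain ⟨d, -, hd⟩ := exists_div k (j := 1) (hj := by decide) (x := x) h1
  obtain ⟨d', -, hd'⟩ := exists_div k (j := 2) (hj := by decide) (x := x) h2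
  have hx : x = x * ee k 0 + d * (ee k 0 * bb k 1) + d' * (ee k 0 * bb k 2) := by
    rw [ee_mul_bb, ee_mul_bb, hd, hd', ← mul_add, ← mul_add, ← one_eq, mul_one]
  rw [hx]
  simp only [add_smul, mul_smul, hC, smul_zero, add_zero]

lemma pd_killed (hC : ∀ c : C, ee k 0 • c = 0) : PdLT (gelfandOrder k) C 2 := by
  let f : C →ₗ[gelfandOrder k] C :=
    { toFun := fun c => ee k 1 • c
      map_add' := fun _ _ => smul_add _ _ _
      map_smul' := fun x c => by
        rw [RingHom.id_apply, ← mul_smul, ← mul_smul, ← sub_eq_zero, ← sub_smul]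
        apply kill k hC
        · show (ee k 1 * x).1 1 1 - (x * ee k 1).1 1 1 ∈ _
          rw [ee_mul_val, mul_ee_val]; simp
        · show (ee k 1 * x).1 2 2 - (x * ee k 1).1 2 2 ∈ _
          rw [ee_mul_val, mul_ee_val]; simp }
  refine pd_mid (N := LinearMap.range f) f.rangeRestrict f.surjective_rangeRestrict ?_ ?_
  · rw [LinearMap.ker_rangeRestrict]
    apply pd_simple k 2 (by decide)
    rintro x hx ⟨c, hc⟩
    apply Subtype.ext
    show x • c = 0
    have hc' : ee k 1 • c = 0 := hc
    have : x • c = (x - x * ee k 1) • c := by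
      rw [sub_smul, mul_smul, hc', smul_zero, sub_zero]
    rw [this]
    apply kill k hC
    · show x.1 1 1 - (x * ee k 1).1 1 1 ∈ _
      rw [mul_ee_val]; simp
    · show x.1 2 2 - (x * ee k 1).1 2 2 ∈ _
      rw [mul_ee_val]; simpa using (mem_J k).1 hx
  · apply pd_simple k 1 (by decide)
    rintro x hx ⟨_, c, rfl⟩
    apply Subtype.ext
    show x • ee k 1 • c = 0
    rw [← mul_smul]
    apply kill k hC
    · rw [mul_ee_val]; simpa using (mem_J k).1 hx
    · rw [mul_ee_val]; simp

lemma pd_all (M : Type) [AddCommGroup M] [Module (gelfandOrder k) M] : PdLT (gelfandOrder k) M 3 := by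
  let _ : Module (PowerSeries k) M := Module.compHom M (algebraMap (PowerSeries k) (gelfandOrder k))
  have : IsScalarTower (PowerSeries k) (gelfandOrder k) M := IsScalarTower.of_compHom (PowerSeries k) (gelfandOrder k) M
  let M1 : Submodule (PowerSeries k) M :=
    { carrier := {m | ee k 0 • m = m}
      zero_mem' := smul_zero _
      add_mem' := fun {x y} hx hy => by
        show ee k 0 • (x + y) = x + y
        rw [smul_add, show ee k 0 • x = x from hx, show ee k 0 • y = y from hy]
      smul_mem' := fun r x hx => by
        show ee k 0 • (r • x) = r • x
        rw [smul_algebra_smul_comm, show ee k 0 • x = x from hx] }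
  have hM1 : ∀ m ∈ M1, ee k 0 • m = m := fun m hm => hm
  have hT : ∀ m : M1, T k M1.subtype (Pi.single 0 m) = m := by
    intro m
    rw [T_apply, Fin.sum_univ_three]
    simp [E_zero, hM1 m.1 m.2]
  refine pd_three (T k M1.subtype) (pd_ind k) (pd_killed k ?_) (pd_killed k ?_)
  · rintro ⟨v, hv⟩
    apply Subtype.ext
    show E k 0 • v = 0
    rw [E_smul]
    have h : T k M1.subtype (E k 0 • v) = 0 := by
      rw [map_smul, show T k M1.subtype v = 0 from hv, smul_zero]
    rw [E_smul, hT] at h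
    rw [show v 0 = 0 from Subtype.ext h, Pi.single_zero]
  · intro c
    obtain ⟨m, rfl⟩ := Submodule.mkQ_surjective _ c
    rw [← map_smul, Submodule.mkQ_apply, Submodule.Quotient.mk_eq_zero]
    refine ⟨Pi.single 0 ⟨ee k 0 • m, ?_⟩, hT _⟩
    show ee k 0 • ee k 0 • m = ee k 0 • m
    rw [← mul_smul, ee_mul_ee]

end simple

theorem ext_bridge {C : Type*} [Category* C] [Abelian C] [Linear k C] [EnoughProjectives C]
    (M N : C) (n : ℕ) [HasProjectiveDimensionLT M (n+1)] :
    Subsingleton ↥(((Ext k C (n+1)).obj (Opposite.op M)).obj N) := by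
  let := HasExt.standard C
  let P := ProjectiveResolution.of M
  refine ModuleCat.subsingleton_of_isZero (Limits.IsZero.of_iso ?_ (P.isoExt (n + 1) N))
  rw [← HomologicalComplex.exactAt_iff_isZero_homology,
    HomologicalComplex.exactAt_iff' _ n (n+1) (n+2) (by simp) (by simp),
    ShortComplex.moduleCat_exact_iff]
  intro (f : P.complex.X (n+1) ⟶ N) hf
  have hf' : P.complex.d (n+2) (n+1) ≫ f = 0 := hf
  have := (P.extMk_eq_zero_iff f (n+2) rfl hf' n rfl).1
    (Abelian.Ext.eq_zero_of_hasProjectiveDimensionLT _ (n+1) le_rfl)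
  exact this

end GelfandAux

open CategoryTheory in
/-- For all left `Λ`-modules `M`, `N` over the Gelfand order and all
`n ≥ 3`, the extension group `Ext^n_Λ(M,N)` vanishes: the global dimension of the
category of left `Λ`-modules is at most two. -/
theorem ext_vanishes_in_degree_ge_three
    (M N : ModuleCat (↥(gelfandOrder k))) (n : ℕ) (hn : 3 ≤ n) :
    Subsingleton ↥(((Ext k (ModuleCat (↥(gelfandOrder k))) n).obj (Opposite.op M)).obj N) := by
  obtain ⟨m, rfl⟩ : ∃ m, n = m + 1 := ⟨n - 1, by omega⟩
  have h3 : HasProjectiveDimensionLT M 3 := GelfandAux.pd_all k M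
  have := hasProjectiveDimensionLT_of_ge M 3 (m + 1) hn
  exact GelfandAux.ext_bridge k M N m
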